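/- Let N ≥ 1 be a natural number, let B₁ be the open unit ball in ℝ^N with Lebesgue volume |B₁|, and let v > 0. Then the Euclidean isochoric torsion profile satisfies 𝒯_{ℝ^N}(v) := inf{ J(Ω) : Ω ⊆ ℝ^N open and bounded with Lebesgue volume |Ω| = v } = (|B₁|/v)^{(N+2)/N} · J(B₁); that is, among all bounded open sets of volume v, balls minimize J (Saint-Venant/Faber–Krahn for the torsion problem), and the value of the infimum is (|B₁|/v)^{(N+2)/N} J(B₁). -/

import Mathlib

open MeasureTheory

/-- The torsional energy of an open set `Ω ⊆ ℝ^N`. -/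
noncomputable def torsionEnergy {N : ℕ} (Ω : Set (EuclideanSpace ℝ (Fin N))) : ℝ :=
  sInf { e : ℝ | ∃ u : EuclideanSpace ℝ (Fin N) → ℝ,
    ContDiff ℝ (⊤ : ℕ∞) u ∧ HasCompactSupport u ∧ tsupport u ⊆ Ω ∧
    (∫ x, u x) = 1 ∧ e = ∫ x, ‖gradient u x‖ ^ 2 }

/-- The Euclidean isochoric torsion profile:
the infimum of `J(Ω)` over bounded open sets of volume `v`. -/
noncomputable def torsionProfile (N : ℕ) (v : ℝ) : ℝ :=
  sInf { e : ℝ | ∃ Ω : Set (EuclideanSpace ℝ (Fin N)),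
    IsOpen Ω ∧ Bornology.IsBounded Ω ∧ volume Ω = ENNReal.ofReal v ∧
    e = torsionEnergy Ω }

open Set Metric Filter Topology
open scoped ENNReal

/-- One-dimensional Brunn–Minkowski inequality. -/
lemma Real.volume_add_volume_le {A B C : Set ℝ} (hA : MeasurableSet A) (hB : MeasurableSet B)
    (hA' : A.Nonempty) (hB' : B.Nonempty) (hC : ∀ a ∈ A, ∀ b ∈ B, a + b ∈ C) :
    volume A + volume B ≤ volume C := by
  have key : ∀ K ⊆ A, ∀ L ⊆ B, IsCompact K → IsCompact L → K.Nonempty → L.Nonempty →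
      volume K + volume L ≤ volume C := by
    intro K hKA L hLB hK hL hKn hLn
    obtain ⟨M, hMK, hM⟩ := hK.exists_isGreatest hKn
    obtain ⟨m, hmL, hm⟩ := hL.exists_isLeast hLn
    have hdisj : AEDisjoint volume ((fun x => -m + x) ⁻¹' K) ((fun x => -M + x) ⁻¹' L) := by
      refine measure_mono_null (t := {m + M}) ?_ (by simp)
      rintro x ⟨hx1, hx2⟩
      have h1 := hM hx1
      have h2 := hm hx2
      simp only [mem_singleton_iff]
      linarith
    have hLm : MeasurableSet ((fun x => -M + x) ⁻¹' L) :=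
      (measurable_const_add _) hL.measurableSet
    calc volume K + volume L
        = volume ((fun x => -m + x) ⁻¹' K) + volume ((fun x => -M + x) ⁻¹' L) := by
          rw [measure_preimage_add, measure_preimage_add]
      _ = volume (((fun x => -m + x) ⁻¹' K) ∪ ((fun x => -M + x) ⁻¹' L)) :=
          (measure_union₀ hLm.nullMeasurableSet hdisj).symm
      _ ≤ volume C := by
          refine measure_mono (union_subset (fun x hx => ?_) (fun x hx => ?_))
          · simpa using hC _ (hKA hx) _ (hLB hmL)
          · simpa using hC _ (hKA hMK) _ (hLB hx)
  obtain ⟨a₀, ha₀⟩ := hA'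
  obtain ⟨b₀, hb₀⟩ := hB'
  have hbound : ∀ r < volume A, ∀ q < volume B, r + q ≤ volume C := by
    intro r hr q hq
    obtain ⟨K, hKA, hK, hrK⟩ := hA.exists_lt_isCompact hr
    obtain ⟨L, hLB, hL, hqL⟩ := hB.exists_lt_isCompact hq
    refine le_trans (add_le_add (hrK.le.trans (measure_mono (subset_insert a₀ K)))
      (hqL.le.trans (measure_mono (subset_insert b₀ L)))) ?_
    exact key _ (insert_subset ha₀ hKA) _ (insert_subset hb₀ hLB) (hK.insert _) (hL.insert _)
      (insert_nonempty _ _) (insert_nonempty _ _)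
  have hAle : volume A ≤ volume C := by
    refine le_of_forall_lt fun r hr => ?_
    obtain ⟨K, hKA, hK, hrK⟩ := hA.exists_lt_isCompact hr
    have := key (insert a₀ K) (insert_subset ha₀ hKA) {b₀} (by simpa) (hK.insert _)
      isCompact_singleton (insert_nonempty _ _) (by simp)
    refine hrK.trans_le ((measure_mono (subset_insert a₀ K)).trans ?_)
    simpa using this
  have hBle : volume B ≤ volume C := by
    refine le_of_forall_lt fun r hr => ?_
    obtain ⟨K, hKB, hK, hrK⟩ := hB.exists_lt_isCompact hr
    have := key {a₀} (by simpa) (insert b₀ K) (insert_subset hb₀ hKB)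
      isCompact_singleton (hK.insert _) (by simp) (insert_nonempty _ _)
    refine hrK.trans_le ((measure_mono (subset_insert b₀ K)).trans ?_)
    simpa using this
  rcases eq_or_ne (volume A) 0 with h0 | h0
  · simpa [h0] using hBle
  rcases eq_or_ne (volume B) 0 with h1 | h1
  · simpa [h1] using hAle
  by_contra! hlt
  obtain ⟨r, hr, q, hq, h⟩ := ENNReal.exists_lt_add_of_lt_add hlt h0 h1
  exact absurd (hbound r hr q hq) (not_le.2 h)

lemma ENNReal.geom_mean_le_arith_mean2_weighted {s t : ℝ} (hs : 0 < s) (ht : 0 < t)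
    (hst : s + t = 1) (a b : ℝ≥0∞) :
    a ^ s * b ^ t ≤ ENNReal.ofReal s * a + ENNReal.ofReal t * b := by
  rcases eq_or_ne a ∞ with rfl | ha
  · simp [ENNReal.mul_top, hs]
  rcases eq_or_ne b ∞ with rfl | hb
  · simp [ENNReal.mul_top, ht]
  lift a to NNReal using ha
  lift b to NNReal using hb
  have h := NNReal.geom_mean_le_arith_mean2_weighted s.toNNReal t.toNNReal a b
    (by rw [← Real.toNNReal_add hs.le ht.le, hst]; simp)
  rw [Real.coe_toNNReal _ hs.le, Real.coe_toNNReal _ ht.le] at h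
  rw [← ENNReal.coe_rpow_of_nonneg _ hs.le, ← ENNReal.coe_rpow_of_nonneg _ ht.le]
  simp only [ENNReal.ofReal]
  exact_mod_cast h

/-- The Prékopa–Leindler inequality holds on `E`. -/
def PrekopaLeindler (E : Type*) [AddCommGroup E] [Module ℝ E] [MeasureSpace E] : Prop :=
  ∀ s t : ℝ, 0 < s → 0 < t → s + t = 1 → ∀ f g h : E → ℝ≥0∞,
    Measurable f → Measurable g → Measurable h →
    (∀ x y, f x ^ s * g y ^ t ≤ h (s • x + t • y)) →
    (∫⁻ x, f x) ^ s * (∫⁻ x, g x) ^ t ≤ ∫⁻ x, h x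

lemma lintegral_add_le_of_superlevel {s t : ℝ} (hs : 0 < s) (ht : 0 < t) {f g h : ℝ → ℝ}
    (hf : Measurable f) (hg : Measurable g) (hh : Measurable h)
    (hf0 : 0 ≤ f) (hg0 : 0 ≤ g) (hh0 : 0 ≤ h) (hf1 : ∀ x, f x ≤ 1) (hg1 : ∀ x, g x ≤ 1)
    (hfs : ∀ c < 1, ∃ x, c < f x) (hgs : ∀ c < 1, ∃ x, c < g x)
    (H : ∀ c, 0 < c → ∀ x y, c < f x → c < g y → c < h (s * x + t * y)) :
    ENNReal.ofReal s * (∫⁻ x, ENNReal.ofReal (f x)) + ENNReal.ofReal t *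
      (∫⁻ x, ENNReal.ofReal (g x)) ≤ ∫⁻ x, ENNReal.ofReal (h x) := by
  rw [lintegral_eq_lintegral_meas_lt _ (.of_forall hf0) hf.aemeasurable,
    lintegral_eq_lintegral_meas_lt _ (.of_forall hg0) hg.aemeasurable,
    lintegral_eq_lintegral_meas_lt _ (.of_forall hh0) hh.aemeasurable]
  have hmeas : ∀ f : ℝ → ℝ, Measurable fun c => volume {a | c < f a} := fun f =>
    Antitone.measurable fun c d hcd => measure_mono fun x hx => lt_of_le_of_lt hcd hx
  rw [← lintegral_const_mul _ (hmeas f), ← lintegral_const_mul _ (hmeas g),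
    ← lintegral_add_left ((hmeas f).const_mul _)]
  refine setLIntegral_mono (hmeas h) fun c hc => ?_
  rcases lt_or_ge c 1 with hc1 | hc1
  · have hsm : ∀ {r : ℝ} (_ : 0 < r) (S : Set ℝ),
        ENNReal.ofReal r * volume S = volume ((fun x => r⁻¹ * x) ⁻¹' S) := by
      intro r hr S
      rw [Real.volume_preimage_mul_left (inv_ne_zero hr.ne')]
      simp [abs_of_pos hr]
    rw [hsm hs, hsm ht]
    obtain ⟨x, hx⟩ := hfs c hc1
    obtain ⟨y, hy⟩ := hgs c hc1
    refine Real.volume_add_volume_le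
      ((measurable_const_mul _) (measurableSet_lt measurable_const hf))
      ((measurable_const_mul _) (measurableSet_lt measurable_const hg))
      ⟨s * x, ?_⟩ ⟨t * y, ?_⟩ ?_
    · simpa [hs.ne'] using hx
    · simpa [ht.ne'] using hy
    · intro a ha b hb
      have := H c hc _ _ ha hb
      simpa [mul_inv_cancel_left₀ hs.ne', mul_inv_cancel_left₀ ht.ne'] using this
  · have h1 : {a | c < f a} = ∅ := by
      ext x; simpa using (hf1 x).trans hc1
    have h2 : {a | c < g a} = ∅ := by
      ext x; simpa using (hg1 x).trans hc1
    simp [h1, h2]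

lemma PrekopaLeindler.real_of_bounded {s t : ℝ} (hs : 0 < s) (ht : 0 < t) (hst : s + t = 1)
    {f g h : ℝ → ℝ≥0∞} (hf : Measurable f) (hg : Measurable g) (hh : Measurable h)
    (hfb : ⨆ x, f x ≠ ∞) (hgb : ⨆ x, g x ≠ ∞)
    (H : ∀ x y, f x ^ s * g y ^ t ≤ h (s * x + t * y)) :
    (∫⁻ x, f x) ^ s * (∫⁻ x, g x) ^ t ≤ ∫⁻ x, h x := by
  set F := ⨆ x, f x with hF
  set G := ⨆ x, g x with hG
  have hfF : ∀ x, f x ≤ F := le_iSup f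
  have hgG : ∀ x, g x ≤ G := le_iSup g
  rcases eq_or_ne F 0 with hF0 | hF0
  · have : f = 0 := funext fun x => le_antisymm ((hfF x).trans hF0.le) bot_le
    simp [this, hs]
  rcases eq_or_ne G 0 with hG0 | hG0
  · have : g = 0 := funext fun x => le_antisymm ((hgG x).trans hG0.le) bot_le
    simp [this, ht]
  set D := F ^ s * G ^ t with hD
  have hD0 : D ≠ 0 := mul_ne_zero (by simp [ENNReal.rpow_eq_zero_iff, hF0, hfb])
    (by simp [ENNReal.rpow_eq_zero_iff, hG0, hgb])
  have hDt : D ≠ ∞ := ENNReal.mul_ne_top (ENNReal.rpow_ne_top_of_nonneg hs.le hfb)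
    (ENNReal.rpow_ne_top_of_nonneg ht.le hgb)
  have hf1 : ∀ x, f x / F ≤ 1 := fun x => ENNReal.div_le_of_le_mul (by simpa using hfF x)
  have hg1 : ∀ x, g x / G ≤ 1 := fun x => ENNReal.div_le_of_le_mul (by simpa using hgG x)
  have hft : ∀ x, f x / F ≠ ∞ := fun x => ne_top_of_le_ne_top ENNReal.one_ne_top (hf1 x)
  have hgt : ∀ x, g x / G ≠ ∞ := fun x => ne_top_of_le_ne_top ENNReal.one_ne_top (hg1 x)
  have hht : ∀ x, min (h x / D) 1 ≠ ∞ := fun x =>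
    ne_top_of_le_ne_top ENNReal.one_ne_top (min_le_right _ _)
  have hsup : ∀ {k : ℝ → ℝ≥0∞} {K : ℝ≥0∞}, K = ⨆ x, k x → K ≠ 0 → K ≠ ∞ →
      (∀ x, k x / K ≠ ∞) → ∀ c < (1 : ℝ), ∃ x, c < (k x / K).toReal := by
    intro k K hK hK0 hKt hkt c hc
    by_contra! hcon
    have hc0 : 0 ≤ c := ENNReal.toReal_nonneg.trans (hcon 0)
    have : K ≤ ENNReal.ofReal c * K := by
      conv_lhs => rw [hK]
      refine iSup_le fun x => ?_
      rw [← ENNReal.div_le_iff hK0 hKt]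
      exact (ENNReal.le_ofReal_iff_toReal_le (hkt x) hc0).2 (hcon x)
    have h2 : ENNReal.ofReal c * K < 1 * K :=
      ENNReal.mul_lt_mul_left hK0 hKt (by simpa using hc)
    rw [one_mul] at h2
    exact absurd this (not_le.2 h2)
  have core := lintegral_add_le_of_superlevel hs ht (f := fun x => (f x / F).toReal)
    (g := fun x => (g x / G).toReal) (h := fun x => (min (h x / D) 1).toReal)
    (hf.div_const _).ennreal_toReal (hg.div_const _).ennreal_toReal
    ((hh.div_const _).min measurable_const).ennreal_toReal
    (fun _ => ENNReal.toReal_nonneg) (fun _ => ENNReal.toReal_nonneg)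
    (fun _ => ENNReal.toReal_nonneg)
    (fun x => ENNReal.toReal_le_of_le_ofReal zero_le_one (by simpa using hf1 x))
    (fun x => ENNReal.toReal_le_of_le_ofReal zero_le_one (by simpa using hg1 x))
    (hsup hF hF0 hfb hft) (hsup hG hG0 hgb hgt) (by
      intro c hc x y hx hy
      rw [← ENNReal.ofReal_lt_iff_lt_toReal hc.le (hft x)] at hx
      rw [← ENNReal.ofReal_lt_iff_lt_toReal hc.le (hgt y)] at hy
      rw [← ENNReal.ofReal_lt_iff_lt_toReal hc.le (hht _)]
      refine lt_min ?_ (hx.trans_le (hf1 x))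
      have hc' : ENNReal.ofReal c = ENNReal.ofReal c ^ s * ENNReal.ofReal c ^ t := by
        rw [← ENNReal.rpow_add_of_nonneg _ _ hs.le ht.le, hst, ENNReal.rpow_one]
      calc ENNReal.ofReal c = ENNReal.ofReal c ^ s * ENNReal.ofReal c ^ t := hc'
        _ < (f x / F) ^ s * (g y / G) ^ t :=
            ENNReal.mul_lt_mul (ENNReal.rpow_lt_rpow hx hs) (ENNReal.rpow_lt_rpow hy ht)
        _ = f x ^ s * g y ^ t / D := by
            rw [ENNReal.div_rpow_of_nonneg _ _ hs.le, ENNReal.div_rpow_of_nonneg _ _ ht.le,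
              ENNReal.mul_div_mul_comm]
            · exact Or.inr (ENNReal.rpow_ne_top_of_nonneg ht.le hgb)
            · exact Or.inl (ENNReal.rpow_ne_top_of_nonneg hs.le hfb)
        _ ≤ _ := ENNReal.div_le_div_right (H x y) _)
  simp only [ENNReal.ofReal_toReal, hft, hgt, hht, ne_eq, not_false_eq_true] at core
  simp only [div_eq_mul_inv] at core
  rw [lintegral_mul_const _ hf, lintegral_mul_const _ hg] at core
  have h3 : ∫⁻ x, min (h x * D⁻¹) 1 ≤ (∫⁻ x, h x) * D⁻¹ := by
    rw [← lintegral_mul_const _ hh]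
    exact lintegral_mono fun x => min_le_left _ _
  have h4 := (ENNReal.geom_mean_le_arith_mean2_weighted hs ht hst _ _).trans (core.trans h3)
  rw [← div_eq_mul_inv, ← div_eq_mul_inv, ← div_eq_mul_inv,
    ENNReal.div_rpow_of_nonneg _ _ hs.le, ENNReal.div_rpow_of_nonneg _ _ ht.le,
    ← ENNReal.mul_div_mul_comm (Or.inr (ENNReal.rpow_ne_top_of_nonneg ht.le hgb))
      (Or.inl (ENNReal.rpow_ne_top_of_nonneg hs.le hfb)), ← hD] at h4
  rwa [ENNReal.div_le_iff hD0 hDt, ENNReal.div_mul_cancel hD0 hDt] at h4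

lemma lintegral_rpow_eq_iSup_min {f : ℝ → ℝ≥0∞} (hf : Measurable f) {s : ℝ} (hs : 0 < s) :
    (∫⁻ x, f x) ^ s = ⨆ n : ℕ, (∫⁻ x, min (f x) n) ^ s := by
  have h1 : ∫⁻ x, f x = ⨆ n : ℕ, ∫⁻ x, min (f x) n := by
    rw [← lintegral_iSup (fun n => hf.min measurable_const)]
    · refine lintegral_congr fun x => ?_
      rw [← inf_iSup_eq, ENNReal.iSup_natCast, inf_top_eq]
    · intro m n hmn x
      exact min_le_min le_rfl (by exact_mod_cast hmn)
  rw [h1]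
  exact (ENNReal.orderIsoRpow s hs).map_iSup _

theorem PrekopaLeindler.real : PrekopaLeindler ℝ := by
  intro s t hs ht hst f g h hf hg hh H
  rw [lintegral_rpow_eq_iSup_min hf hs, lintegral_rpow_eq_iSup_min hg ht, ENNReal.iSup_mul]
  refine iSup_le fun n => ?_
  rw [ENNReal.mul_iSup]
  refine iSup_le fun m => ?_
  have hb : ∀ (k : ℝ → ℝ≥0∞) (n : ℕ), ⨆ x, min (k x) n ≠ ∞ := fun k n =>
    ne_top_of_le_ne_top (ENNReal.natCast_ne_top n) (iSup_le fun x => min_le_right _ _)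
  refine PrekopaLeindler.real_of_bounded hs ht hst (hf.min measurable_const)
    (hg.min measurable_const) hh (hb f n) (hb g m) fun x y => ?_
  refine le_trans ?_ (H x y)
  gcongr <;> exact min_le_left _ _

/-- The Prékopa–Leindler inequality passes to products. -/
theorem PrekopaLeindler.prod {E F : Type*} [AddCommGroup E] [Module ℝ E] [MeasureSpace E]
    [AddCommGroup F] [Module ℝ F] [MeasureSpace F] [SFinite (volume : Measure F)]
    (hE : PrekopaLeindler E) (hF : PrekopaLeindler F) : PrekopaLeindler (E × F) := by
  intro s t hs ht hst f g h hf hg hh H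
  rw [Measure.volume_eq_prod, lintegral_prod _ hf.aemeasurable, lintegral_prod _ hg.aemeasurable,
    lintegral_prod _ hh.aemeasurable]
  refine hE s t hs ht hst _ _ _ hf.lintegral_prod_right' hg.lintegral_prod_right'
    hh.lintegral_prod_right' fun x y => ?_
  refine hF s t hs ht hst _ _ _ (hf.comp measurable_prodMk_left)
    (hg.comp measurable_prodMk_left) (hh.comp measurable_prodMk_left) fun a b => ?_
  exact H (x, a) (y, b)

/-- The Prékopa–Leindler inequality passes to images under measure-preserving linear maps. -/
theorem PrekopaLeindler.of_measurePreserving {E F : Type*} [AddCommGroup E] [Module ℝ E]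
    [MeasureSpace E] [AddCommGroup F] [Module ℝ F] [MeasureSpace F] (hE : PrekopaLeindler E)
    (L : E →ₗ[ℝ] F) (hL : MeasurePreserving L) : PrekopaLeindler F := by
  intro s t hs ht hst f g h hf hg hh H
  rw [← hL.lintegral_comp hf, ← hL.lintegral_comp hg, ← hL.lintegral_comp hh]
  refine hE s t hs ht hst _ _ _ (hf.comp hL.measurable) (hg.comp hL.measurable)
    (hh.comp hL.measurable) fun x y => ?_
  simpa using H (L x) (L y)

theorem PrekopaLeindler.pi (n : ℕ) : PrekopaLeindler (Fin n → ℝ) := by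
  induction n with
  | zero =>
    intro s t hs ht hst f g h hf hg hh H
    have hvol : (volume : Measure (Fin 0 → ℝ)) = Measure.dirac 0 := Measure.volume_pi_eq_dirac 0
    simpa [hvol] using H 0 0
  | succ n ih =>
    refine (PrekopaLeindler.real.prod ih).of_measurePreserving
      (Fin.consLinearEquiv ℝ (fun _ : Fin (n + 1) => ℝ)).toLinearMap ?_
    have hL : ((Fin.consLinearEquiv ℝ (fun _ : Fin (n + 1) => ℝ)).toLinearMap :
        ℝ × (Fin n → ℝ) → Fin (n + 1) → ℝ) =
        (MeasurableEquiv.piFinSuccAbove (fun _ : Fin (n + 1) => ℝ) 0).symm := by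
      ext p i
      refine Fin.cases ?_ (fun j => ?_) i <;>
        simp [MeasurableEquiv.piFinSuccAbove, Fin.consLinearEquiv]
    rw [hL]
    exact (volume_preserving_piFinSuccAbove (fun _ : Fin (n + 1) => ℝ) 0).symm

theorem PrekopaLeindler.euclideanSpace (n : ℕ) : PrekopaLeindler (EuclideanSpace ℝ (Fin n)) :=
  (PrekopaLeindler.pi n).of_measurePreserving
    (WithLp.linearEquiv 2 ℝ (Fin n → ℝ)).symm.toLinearMap (PiLp.volume_preserving_toLp (Fin n))

/-- Brunn–Minkowski inequality for two sets of equal volume. -/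
theorem PrekopaLeindler.volume_le {E : Type*} [NormedAddCommGroup E] [NormedSpace ℝ E]
    [MeasureSpace E] [BorelSpace E] [FiniteDimensional ℝ E]
    [(volume : Measure E).IsAddHaarMeasure] (hE : PrekopaLeindler E) {A B C : Set E}
    (hA : MeasurableSet A) (hB : MeasurableSet B) (hC : MeasurableSet C)
    (hAB : volume A = volume B) {ε : ℝ} (hε : 0 < ε) (H : ∀ a ∈ A, ∀ b ∈ B, a + ε • b ∈ C) :
    ENNReal.ofReal ((1 + ε) ^ Module.finrank ℝ E) * volume B ≤ volume C := by
  have h1 : 0 < 1 + ε := by positivity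
  have hs : 0 < 1 / (1 + ε) := by positivity
  have ht : 0 < ε / (1 + ε) := by positivity
  have hst : 1 / (1 + ε) + ε / (1 + ε) = 1 := by field_simp
  have hC' : MeasurableSet ((fun x : E => (1 + ε) • x) ⁻¹' C) := measurable_const_smul _ hC
  have := hE _ _ hs ht hst (A.indicator 1) (B.indicator 1)
    (((fun x : E => (1 + ε) • x) ⁻¹' C).indicator 1) (measurable_one.indicator hA)
    (measurable_one.indicator hB) (measurable_one.indicator hC') (by
      intro x y
      by_cases hx : x ∈ A
      · by_cases hy : y ∈ B
        · have hmem : (1 / (1 + ε)) • x + (ε / (1 + ε)) • y ∈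
              (fun x : E => (1 + ε) • x) ⁻¹' C := by
            have := H x hx y hy
            simpa [smul_smul, mul_inv_cancel₀ h1.ne', mul_div_cancel₀ _ h1.ne'] using this
          simp only [indicator_of_mem hx, indicator_of_mem hy, indicator_of_mem hmem]
          simp
        · simp [indicator_of_notMem hy, ht]
      · rw [indicator_of_notMem hx, ENNReal.zero_rpow_of_pos hs]; simp)
  rw [lintegral_indicator_one hA, lintegral_indicator_one hB, lintegral_indicator_one hC', hAB,
    ← ENNReal.rpow_add_of_nonneg _ _ hs.le ht.le, hst, ENNReal.rpow_one,
    Measure.addHaar_preimage_smul _ h1.ne'] at this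
  calc ENNReal.ofReal ((1 + ε) ^ Module.finrank ℝ E) * volume B
      ≤ ENNReal.ofReal ((1 + ε) ^ Module.finrank ℝ E) *
        (ENNReal.ofReal |((1 + ε) ^ Module.finrank ℝ E)⁻¹| * volume C) := by gcongr
    _ = volume C := by
        rw [← mul_assoc, ← ENNReal.ofReal_mul (by positivity), abs_of_pos (by positivity),
          mul_inv_cancel₀ (by positivity), ENNReal.ofReal_one, one_mul]

section Dirichlet

variable {N : ℕ}

local notation "𝔼" => EuclideanSpace ℝ (Fin N)

lemma sub_smul_le_of_lipschitzWith_fderiv {u : 𝔼 → ℝ} (hu : Differentiable ℝ u) {L : NNReal}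
    (hL : LipschitzWith L (fderiv ℝ u)) {ε ρ : ℝ} (hε : 0 ≤ ε) {y : 𝔼} (hy : ‖y‖ ≤ ρ) (z : 𝔼) :
    u (z - ε • y) + ε * ((ρ ^ 2 - ‖y‖ ^ 2) / 2) ≤
      u z + ε / 2 * ‖fderiv ℝ u z‖ ^ 2 + (ε * ρ ^ 2 / 2 + L * ε ^ 2 * ρ ^ 2) := by
  have hρ : 0 ≤ ρ := (norm_nonneg y).trans hy
  have hn : ‖(z - ε • y) - z‖ ≤ ε * ρ := by
    rw [sub_sub_cancel_left, norm_neg, norm_smul, Real.norm_of_nonneg hε]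
    gcongr
  have h1 := (convex_closedBall z (ε * ρ)).norm_image_sub_le_of_norm_fderiv_le'
    (f := u) (φ := fderiv ℝ u z) (C := L * (ε * ρ)) (x := z) (y := z - ε • y)
    (fun x _ => hu x) (fun x hx => by
      refine (hL.norm_sub_le x z).trans ?_
      gcongr
      simpa [dist_eq_norm] using hx)
    (mem_closedBall_self (by positivity)) (by simpa [dist_eq_norm] using hn)
  have h2 : L * (ε * ρ) * ‖(z - ε • y) - z‖ ≤ L * (ε * ρ) * (ε * ρ) := by gcongr
  have h3 := (le_abs_self _).trans (h1.trans h2)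
  rw [sub_sub_cancel_left, map_neg, map_smul, smul_eq_mul] at h3
  have h4 : -(fderiv ℝ u z y) ≤ ‖fderiv ℝ u z‖ * ‖y‖ :=
    (neg_le_abs _).trans ((fderiv ℝ u z).le_opNorm y)
  have h5 : -(fderiv ℝ u z y) ≤ ‖fderiv ℝ u z‖ ^ 2 / 2 + ‖y‖ ^ 2 / 2 := by
    nlinarith [sq_nonneg (‖fderiv ℝ u z‖ - ‖y‖)]
  nlinarith [mul_le_mul_of_nonneg_left h5 hε]

/-- A Minkowski-type first variation inequality, obtained from the Brunn–Minkowski inequality for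
the subgraphs of `u` and of the torsion function of a ball. -/
theorem dirichlet_lower_bound {u : 𝔼 → ℝ} (hu : ContDiff ℝ (⊤ : ℕ∞) u)
    (hc : HasCompactSupport u) {ρ β : ℝ} (hρ : 0 < ρ) (hβ : 0 ≤ β)
    (hβ' : ∫⁻ y in ball (0 : 𝔼) ρ, ENNReal.ofReal ((ρ ^ 2 - ‖y‖ ^ 2) / 2) = ENNReal.ofReal β)
    (huβ : ∫⁻ x, ENNReal.ofReal (u x) = ENNReal.ofReal β) :
    (N + 1) * β ≤ (∫ x, ‖fderiv ℝ u x‖ ^ 2) / 2 + ρ ^ 2 / 2 * volume.real (tsupport u) := by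
  have hdu : ContDiff ℝ (⊤ : ℕ∞) (fderiv ℝ u) := hu.fderiv_right (by simp)
  have hdc : HasCompactSupport (fderiv ℝ u) := hc.fderiv ℝ
  obtain ⟨L, hL⟩ := hdu.lipschitzWith_of_hasCompactSupport hdc (by simp)
  have hudiff : Differentiable ℝ u := hu.differentiable (by simp)
  set D := ∫ x, ‖fderiv ℝ u x‖ ^ 2 with hD
  have hD0 : 0 ≤ D := integral_nonneg fun x => by positivity
  have hcont : Continuous fun x => ‖fderiv ℝ u x‖ ^ 2 := hdu.continuous.norm.pow 2
  have hDint : Integrable fun x => ‖fderiv ℝ u x‖ ^ 2 :=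
    hcont.integrable_of_hasCompactSupport
      (hdc.comp_left (g := fun l : 𝔼 →L[ℝ] ℝ => ‖l‖ ^ 2) (by simp))
  have hDl : ∫⁻ x, ENNReal.ofReal (‖fderiv ℝ u x‖ ^ 2) = ENNReal.ofReal D :=
    (ofReal_integral_eq_lintegral_ofReal hDint (.of_forall fun x => by positivity)).symm
  set K := tsupport u with hK
  have hKc : IsCompact K := hc
  have hBM : ∀ ε > 0, (N + 1) * β ≤
      D / 2 + (ρ ^ 2 / 2 + L * ε * ρ ^ 2) * volume.real (cthickening (ε * ρ) K) := by
    intro ε hε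
    set Kε := cthickening (ε * ρ) K with hKε
    have hKεc : IsCompact Kε := hKc.cthickening
    set e := ε * ρ ^ 2 / 2 + L * ε ^ 2 * ρ ^ 2 with he
    have he0 : 0 ≤ e := by positivity
    set H : 𝔼 → ℝ := fun z => u z + ε / 2 * ‖fderiv ℝ u z‖ ^ 2 + e with hH
    have hHm : Measurable H := ((hu.continuous.add (continuous_const.mul hcont)).add
      continuous_const).measurable
    set A : Set (𝔼 × ℝ) := regionBetween 0 u univ with hA
    set B : Set (𝔼 × ℝ) := regionBetween 0 (fun y => (ρ ^ 2 - ‖y‖ ^ 2) / 2) (ball 0 ρ) with hB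
    set C : Set (𝔼 × ℝ) := regionBetween 0 H Kε with hC
    have hum := hu.continuous.measurable
    have hgm : Measurable fun y : 𝔼 => (ρ ^ 2 - ‖y‖ ^ 2) / 2 := by fun_prop
    have hvA : volume A = ENNReal.ofReal β := by
      rw [Measure.volume_eq_prod, hA, volume_regionBetween_eq_lintegral measurable_zero.aemeasurable
        hum.aemeasurable MeasurableSet.univ, ← huβ]
      simp
    have hvB : volume B = ENNReal.ofReal β := by
      rw [Measure.volume_eq_prod, hB, volume_regionBetween_eq_lintegral measurable_zero.aemeasurable
        hgm.aemeasurable measurableSet_ball, ← hβ']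
      simp
    have hvC : volume C ≤ ENNReal.ofReal (β + ε / 2 * D + e * volume.real Kε) := by
      rw [Measure.volume_eq_prod, hC, volume_regionBetween_eq_lintegral measurable_zero.aemeasurable
        hHm.aemeasurable hKεc.measurableSet]
      calc ∫⁻ z in Kε, ENNReal.ofReal ((H - 0) z)
          ≤ ∫⁻ z in Kε, (ENNReal.ofReal (u z) +
              ENNReal.ofReal (ε / 2) * ENNReal.ofReal (‖fderiv ℝ u z‖ ^ 2) +
                ENNReal.ofReal e) := by
            refine lintegral_mono fun z => ?_
            simp only [sub_zero, hH]
            rw [← ENNReal.ofReal_mul (by positivity)]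
            exact ENNReal.ofReal_add_le.trans (by gcongr; exact ENNReal.ofReal_add_le)
        _ = (∫⁻ z in Kε, ENNReal.ofReal (u z)) +
              ENNReal.ofReal (ε / 2) * (∫⁻ z in Kε, ENNReal.ofReal (‖fderiv ℝ u z‖ ^ 2)) +
                ENNReal.ofReal e * volume Kε := by
            rw [lintegral_add_right _ measurable_const, lintegral_add_left hum.ennreal_ofReal,
              lintegral_const_mul _ hcont.measurable.ennreal_ofReal, setLIntegral_const]
        _ ≤ ENNReal.ofReal β + ENNReal.ofReal (ε / 2) * ENNReal.ofReal D +
              ENNReal.ofReal e * ENNReal.ofReal (volume.real Kε) := by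
            rw [← huβ, ← hDl, measureReal_def, ENNReal.ofReal_toReal hKεc.measure_lt_top.ne]
            gcongr <;> exact Measure.restrict_le_self
        _ = _ := by
            rw [← ENNReal.ofReal_mul (by positivity), ← ENNReal.ofReal_mul he0,
              ← ENNReal.ofReal_add hβ (by positivity),
              ← ENNReal.ofReal_add (by positivity) (by positivity)]
    have : (volume : Measure (𝔼 × ℝ)).IsAddHaarMeasure := by
      rw [Measure.volume_eq_prod]; infer_instance
    have hmain := ((PrekopaLeindler.euclideanSpace N).prod PrekopaLeindler.real).volume_le
      (A := A) (B := B) (C := C) (measurableSet_regionBetween measurable_zero hum MeasurableSet.univ)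
      (measurableSet_regionBetween measurable_zero hgm measurableSet_ball)
      (measurableSet_regionBetween measurable_zero hHm hKεc.measurableSet)
      (hvA.trans hvB.symm) hε (by
        rintro ⟨x, τ⟩ ⟨-, hτ0, hτ⟩ ⟨y, r⟩ ⟨hy, hr0, hr⟩
        simp only [Pi.zero_apply, mem_ball_zero_iff] at hτ0 hτ hy hr0 hr
        have hxK : x ∈ K := subset_tsupport u (by simpa using (hτ0.trans hτ).ne')
        refine ⟨?_, ?_, ?_⟩
        · refine mem_cthickening_of_dist_le _ x _ _ hxK ?_
          simp only [Prod.smul_mk, Prod.mk_add_mk, dist_eq_norm, add_sub_cancel_left, norm_smul,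
            Real.norm_of_nonneg hε.le]
          gcongr
        · simp only [Prod.smul_mk, Prod.mk_add_mk, Pi.zero_apply, smul_eq_mul]
          positivity
        · have := sub_smul_le_of_lipschitzWith_fderiv hudiff hL hε.le hy.le (x + ε • y)
          simp only [add_sub_cancel_right] at this
          simp only [Prod.smul_mk, Prod.mk_add_mk, smul_eq_mul, hH, he]
          have := mul_lt_mul_of_pos_left hr hε
          linarith)
    rw [hvB, ← ENNReal.ofReal_mul (by positivity)] at hmain
    have hfin : Module.finrank ℝ (𝔼 × ℝ) = N + 1 := by simp
    rw [hfin] at hmain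
    have hreal := (ENNReal.ofReal_le_ofReal_iff (by positivity)).1 (hmain.trans hvC)
    have hbern : 1 + (N + 1) * ε ≤ (1 + ε) ^ (N + 1) := by
      have := one_add_mul_le_pow (a := ε) (by linarith) (N + 1)
      push_cast at this
      exact this
    have h6 := (mul_le_mul_of_nonneg_right hbern hβ).trans hreal
    have h7 : ε * ((N + 1) * β) ≤
        ε * (D / 2 + (ρ ^ 2 / 2 + L * ε * ρ ^ 2) * volume.real Kε) := by
      rw [he] at h6
      linarith
    exact le_of_mul_le_mul_left h7 hε
  have hlim : Tendsto (fun ε : ℝ =>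
      D / 2 + (ρ ^ 2 / 2 + L * ε * ρ ^ 2) * volume.real (cthickening (ε * ρ) K)) (𝓝[>] 0)
      (𝓝 (D / 2 + (ρ ^ 2 / 2 + L * 0 * ρ ^ 2) * volume.real K)) := by
    have hε : Tendsto (fun ε : ℝ => ε) (𝓝[>] 0) (𝓝 0) := nhdsWithin_le_nhds
    have hvol : Tendsto (fun ε : ℝ => volume.real (cthickening (ε * ρ) K)) (𝓝[>] 0)
        (𝓝 (volume.real K)) := by
      refine (ENNReal.tendsto_toReal hKc.measure_lt_top.ne).comp
        ((tendsto_measure_cthickening_of_isCompact hKc).comp ?_)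
      simpa using hε.mul_const ρ
    exact tendsto_const_nhds.add
      ((tendsto_const_nhds.add ((hε.const_mul _).mul_const _)).mul hvol)
  have := ge_of_tendsto hlim (eventually_mem_nhdsWithin.mono fun ε hε => hBM ε hε)
  simpa using this

lemma setIntegral_ball_norm_sq (hN : 1 ≤ N) {ρ : ℝ} (hρ : 0 < ρ) :
    ∫ x in ball (0 : 𝔼) ρ, ‖x‖ ^ 2 =
      N / (N + 2) * (ρ ^ (N + 2) * volume.real (ball (0 : 𝔼) 1)) := by
  have : Nonempty (Fin N) := ⟨⟨0, hN⟩⟩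
  have h1 : ∀ x : 𝔼, (ball (0 : 𝔼) ρ).indicator (fun x => ‖x‖ ^ 2) x =
      (Iio ρ).indicator (fun r : ℝ => r ^ 2) ‖x‖ := by
    intro x
    by_cases hx : ‖x‖ < ρ
    · rw [indicator_of_mem (by simpa using hx), indicator_of_mem (by simpa using hx)]
    · rw [indicator_of_notMem (by simpa using hx), indicator_of_notMem (by simpa using hx)]
  have h2 : ∫ y in Ioi (0 : ℝ), y ^ (N - 1) • (Iio ρ).indicator (fun r : ℝ => r ^ 2) y =
      ρ ^ (N + 2) / (N + 2) := by
    have h3 : ∀ y : ℝ, y ^ (N - 1) • (Iio ρ).indicator (fun r : ℝ => r ^ 2) y =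
        (Iio ρ).indicator (fun r : ℝ => r ^ (N + 1)) y := by
      intro y
      by_cases hy : y ∈ Iio ρ
      · rw [indicator_of_mem hy, indicator_of_mem hy, smul_eq_mul, ← pow_add]
        congr 1
        omega
      · simp [indicator_of_notMem hy]
    simp_rw [h3]
    rw [setIntegral_indicator measurableSet_Iio, Ioi_inter_Iio, ← integral_Ioc_eq_integral_Ioo,
      ← intervalIntegral.integral_of_le hρ.le, integral_pow]
    push_cast
    simp
    ring
  rw [← integral_indicator measurableSet_ball]
  simp_rw [h1]
  rw [integral_fun_norm_addHaar, finrank_euclideanSpace_fin, h2]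
  simp only [nsmul_eq_mul, smul_eq_mul]
  ring

lemma volume_real_ball {ρ : ℝ} (hρ : 0 < ρ) :
    volume.real (ball (0 : 𝔼) ρ) = ρ ^ N * volume.real (ball (0 : 𝔼) 1) := by
  simp [measureReal_def, Measure.addHaar_ball_of_pos volume (0 : 𝔼) hρ, hρ.le]

lemma setIntegral_ball_sub_norm_sq (hN : 1 ≤ N) {ρ : ℝ} (hρ : 0 < ρ) (c : ℝ) :
    ∫ x in ball (0 : 𝔼) ρ, (ρ ^ 2 - ‖x‖ ^ 2 - c) =
      (2 / (N + 2) * ρ ^ (N + 2) - c * ρ ^ N) * volume.real (ball (0 : 𝔼) 1) := by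
  have hint : ∀ f : 𝔼 → ℝ, Continuous f → IntegrableOn f (ball (0 : 𝔼) ρ) := fun f hf =>
    (hf.continuousOn.integrableOn_compact (isCompact_closedBall 0 ρ)).mono_set
      ball_subset_closedBall
  rw [integral_sub (hint _ (by fun_prop)) (hint _ (by fun_prop)),
    integral_sub (hint _ (by fun_prop)) (hint _ (by fun_prop)), setIntegral_ball_norm_sq hN hρ,
    setIntegral_const, setIntegral_const, volume_real_ball hρ]
  simp only [smul_eq_mul]
  field_simp
  ring

lemma volume_real_ball_pos : 0 < volume.real (ball (0 : 𝔼) 1) :=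
  ENNReal.toReal_pos (measure_ball_pos _ _ one_pos).ne' measure_ball_lt_top.ne

/-- The sharp inequality `(∫ u)² ≤ T ∫ ‖∇u‖²`, where `T` is the torsion of the ball whose volume
bounds that of the support of `u`. -/
theorem le_integral_norm_fderiv_sq (hN : 1 ≤ N) {u : 𝔼 → ℝ} (hu : ContDiff ℝ (⊤ : ℕ∞) u)
    (hc : HasCompactSupport u) (h1 : ∫ x, u x = 1) {ρ : ℝ} (hρ : 0 < ρ)
    (hv : volume.real (tsupport u) ≤ volume.real (ball (0 : 𝔼) ρ)) :
    N * (N + 2) / (ρ ^ (N + 2) * volume.real (ball (0 : 𝔼) 1)) ≤ ∫ x, ‖fderiv ℝ u x‖ ^ 2 := by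
  set ω := volume.real (ball (0 : 𝔼) 1) with hω
  have hω0 : 0 < ω := volume_real_ball_pos
  set q := ρ ^ (N + 2) * ω with hq
  have hq0 : 0 < q := by positivity
  set β := q / (N + 2) with hβ
  have hβ0 : 0 < β := by positivity
  have hβ' : ∫⁻ y in ball (0 : 𝔼) ρ, ENNReal.ofReal ((ρ ^ 2 - ‖y‖ ^ 2) / 2) =
      ENNReal.ofReal β := by
    rw [← ofReal_integral_eq_lintegral_ofReal]
    · rw [integral_div]
      have := setIntegral_ball_sub_norm_sq hN hρ 0
      simp only [sub_zero] at this
      rw [this, hβ, hq]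
      congr 1
      field_simp
      ring
    · have : Continuous fun y : 𝔼 => (ρ ^ 2 - ‖y‖ ^ 2) / 2 := by fun_prop
      exact (this.continuousOn.integrableOn_compact (isCompact_closedBall 0 ρ)).mono_set
        ball_subset_closedBall
    · refine (ae_restrict_iff' measurableSet_ball).2 (.of_forall fun y hy => ?_)
      have hy' : ‖y‖ < ρ := by simpa using hy
      have : ‖y‖ ^ 2 ≤ ρ ^ 2 := by gcongr
      simp only [Pi.zero_apply]
      linarith
  have hint : Integrable u := hu.continuous.integrable_of_hasCompactSupport hc
  set a := (∫⁻ x, ENNReal.ofReal (u x)).toReal with ha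
  have hla : ∫⁻ x, ENNReal.ofReal (u x) = ENNReal.ofReal a :=
    (ENNReal.ofReal_toReal hint.lintegral_lt_top.ne).symm
  have ha1 : 1 ≤ a := by
    rw [integral_eq_lintegral_pos_part_sub_lintegral_neg_part hint] at h1
    have : 0 ≤ (∫⁻ x, ENNReal.ofReal (-u x)).toReal := ENNReal.toReal_nonneg
    linarith
  have ha0 : 0 < a := by linarith
  have ht0 : 0 < β / a := by positivity
  have hts : tsupport (fun x => β / a * u x) ⊆ tsupport u := tsupport_mul_subset_right
  have key := dirichlet_lower_bound (u := fun x => β / a * u x) (contDiff_const.mul hu)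
    (hc.mul_left (f := fun _ => β / a)) hρ hβ0.le hβ' (by
      simp_rw [ENNReal.ofReal_mul ht0.le]
      rw [lintegral_const_mul _ hu.continuous.measurable.ennreal_ofReal, hla,
        ← ENNReal.ofReal_mul ht0.le, div_mul_cancel₀ _ ha0.ne'])
  have hfd : ∀ x, ‖fderiv ℝ (fun x => β / a * u x) x‖ ^ 2 =
      (β / a) ^ 2 * ‖fderiv ℝ u x‖ ^ 2 := by
    intro x
    rw [fderiv_const_mul ((hu.differentiable (by simp)) x), norm_smul, mul_pow,
      Real.norm_of_nonneg ht0.le]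
  simp_rw [hfd] at key
  rw [integral_const_mul] at key
  set D := ∫ x, ‖fderiv ℝ u x‖ ^ 2 with hD
  have hvol : volume.real (tsupport fun x => β / a * u x) ≤ ρ ^ N * ω := by
    rw [← volume_real_ball hρ]
    exact (measureReal_mono hts hc.measure_lt_top.ne).trans hv
  have h8 : ρ ^ 2 / 2 * volume.real (tsupport fun x => β / a * u x) ≤ q / 2 := by
    calc _ ≤ ρ ^ 2 / 2 * (ρ ^ N * ω) := by gcongr
      _ = q / 2 := by rw [hq]; ring
  have h9 : (N + 1) * β ≤ (β / a) ^ 2 * D / 2 + q / 2 := key.trans (by gcongr)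
  have hD0 : 0 ≤ D := integral_nonneg fun x => by positivity
  have h10 : (β / a) ^ 2 * D ≤ β ^ 2 * D := by
    gcongr
    exact div_le_self hβ0.le ha1
  have h11 : q = (N + 2) * β := by rw [hβ]; field_simp
  rw [h11, div_le_iff₀ (by positivity)]
  have h12 : N * β ≤ β ^ 2 * D := by
    rw [h11] at h9
    linarith
  have h13 : β * N ≤ β * (β * D) := by linarith
  have h14 := le_of_mul_le_mul_left h13 hβ0
  nlinarith [mul_le_mul_of_nonneg_left h14 (by positivity : (0 : ℝ) ≤ N + 2)]

/-- A smooth function approximating the positive part. -/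
noncomputable def smoothPosPart (δ t : ℝ) : ℝ :=
  ∫ s in (0 : ℝ)..t, Real.smoothTransition (s / δ - 1)

lemma continuous_smoothTransition_div_sub_one (δ : ℝ) :
    Continuous fun s : ℝ => Real.smoothTransition (s / δ - 1) :=
  Real.smoothTransition.continuous.comp (by fun_prop)

lemma hasDerivAt_smoothPosPart (δ t : ℝ) :
    HasDerivAt (smoothPosPart δ) (Real.smoothTransition (t / δ - 1)) t :=
  (continuous_smoothTransition_div_sub_one δ).integral_hasStrictDerivAt 0 t |>.hasDerivAt

lemma contDiff_smoothPosPart (δ : ℝ) : ContDiff ℝ (⊤ : ℕ∞) (smoothPosPart δ) := by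
  refine contDiff_infty_iff_deriv.2
    ⟨fun t => (hasDerivAt_smoothPosPart δ t).differentiableAt, ?_⟩
  have : deriv (smoothPosPart δ) = fun t => Real.smoothTransition (t / δ - 1) :=
    funext fun t => (hasDerivAt_smoothPosPart δ t).deriv
  rw [this]
  exact Real.smoothTransition.contDiff.comp ((contDiff_id.div_const δ).sub contDiff_const)

lemma smoothPosPart_eq_zero {δ t : ℝ} (hδ : 0 < δ) (ht : t ≤ δ) : smoothPosPart δ t = 0 := by
  refine intervalIntegral.integral_zero_ae (.of_forall fun s hs => ?_)
  refine Real.smoothTransition.zero_of_nonpos ?_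
  have : s ≤ δ := hs.2.trans (max_le hδ.le ht)
  rw [sub_nonpos]
  exact (div_le_one hδ).2 this

lemma smoothPosPart_nonneg {δ : ℝ} (hδ : 0 < δ) (t : ℝ) : 0 ≤ smoothPosPart δ t := by
  rcases le_total t 0 with ht | ht
  · exact (smoothPosPart_eq_zero hδ (ht.trans hδ.le)).ge
  · exact intervalIntegral.integral_nonneg ht fun s _ => Real.smoothTransition.nonneg _

lemma sub_le_smoothPosPart {δ : ℝ} (hδ : 0 < δ) (t : ℝ) : t - 2 * δ ≤ smoothPosPart δ t := by
  rcases le_total t (2 * δ) with ht | ht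
  · linarith [smoothPosPart_nonneg hδ t]
  · have hii : ∀ a b, IntervalIntegrable (fun s : ℝ => Real.smoothTransition (s / δ - 1))
        volume a b := fun a b => (continuous_smoothTransition_div_sub_one δ).intervalIntegrable a b
    have h1 : smoothPosPart δ t = smoothPosPart δ (2 * δ) +
        ∫ s in (2 * δ)..t, Real.smoothTransition (s / δ - 1) :=
      (intervalIntegral.integral_add_adjacent_intervals (hii _ _) (hii _ _)).symm
    have h2 : ∫ s in (2 * δ)..t, Real.smoothTransition (s / δ - 1) = ∫ _s in (2 * δ)..t, (1 : ℝ) := by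
      refine intervalIntegral.integral_congr fun s hs => ?_
      rw [uIcc_of_le ht] at hs
      refine Real.smoothTransition.one_of_one_le ?_
      have : 2 ≤ s / δ := (le_div_iff₀ hδ).2 hs.1
      linarith
    rw [h1, h2]
    simpa using smoothPosPart_nonneg hδ (2 * δ)

lemma torsionEnergy_bddBelow (Ω : Set 𝔼) : BddBelow { e : ℝ | ∃ u : 𝔼 → ℝ,
    ContDiff ℝ (⊤ : ℕ∞) u ∧ HasCompactSupport u ∧ tsupport u ⊆ Ω ∧
    (∫ x, u x) = 1 ∧ e = ∫ x, ‖gradient u x‖ ^ 2 } := by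
  refine ⟨0, ?_⟩
  rintro e ⟨u, -, -, -, -, rfl⟩
  exact integral_nonneg fun x => by positivity

lemma norm_gradient (u : 𝔼 → ℝ) (x : 𝔼) : ‖gradient u x‖ = ‖fderiv ℝ u x‖ := by
  simp [gradient]

lemma torsionEnergy_nonneg (Ω : Set 𝔼) : 0 ≤ torsionEnergy Ω := by
  refine Real.sInf_nonneg ?_
  rintro e ⟨u, -, -, -, -, rfl⟩
  exact integral_nonneg fun x => by positivity

/-- Upper bound for the energy by the Rayleigh quotient of a test function. -/
lemma torsionEnergy_mul_sq_le {Ω : Set 𝔼} {w : 𝔼 → ℝ} (hw : ContDiff ℝ (⊤ : ℕ∞) w)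
    (hc : HasCompactSupport w) (hΩ : tsupport w ⊆ Ω) (hI : 0 < ∫ x, w x) :
    torsionEnergy Ω * (∫ x, w x) ^ 2 ≤ ∫ x, ‖fderiv ℝ w x‖ ^ 2 := by
  set I := ∫ x, w x with hI'
  rw [← le_div_iff₀ (by positivity)]
  refine csInf_le (torsionEnergy_bddBelow Ω) ⟨fun x => I⁻¹ * w x, contDiff_const.mul hw,
    hc.mul_left (f := fun _ => I⁻¹), tsupport_mul_subset_right.trans hΩ, ?_, ?_⟩
  · rw [integral_const_mul, ← hI', inv_mul_cancel₀ hI.ne']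
  · have hfd : ∀ x, ‖gradient (fun x => I⁻¹ * w x) x‖ ^ 2 =
        (I⁻¹) ^ 2 * ‖fderiv ℝ w x‖ ^ 2 := by
      intro x
      rw [norm_gradient, fderiv_const_mul ((hw.differentiable (by simp)) x), norm_smul, mul_pow,
        Real.norm_of_nonneg (by positivity)]
    simp_rw [hfd]
    rw [integral_const_mul]
    field_simp

lemma torsionEnergy_ball_le (hN : 1 ≤ N) {ρ : ℝ} (hρ : 0 < ρ) :
    torsionEnergy (ball (0 : 𝔼) ρ) ≤
      N * (N + 2) / (ρ ^ (N + 2) * volume.real (ball (0 : 𝔼) 1)) := by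
  set ω := volume.real (ball (0 : 𝔼) 1) with hω
  have hω0 : 0 < ω := volume_real_ball_pos
  set J := torsionEnergy (ball (0 : 𝔼) ρ) with hJ
  have hJ0 : 0 ≤ J := torsionEnergy_nonneg _
  have key : ∀ δ > 0, 0 < (2 / (N + 2) * ρ ^ (N + 2) - 2 * δ * ρ ^ N) * ω →
      J * ((2 / (N + 2) * ρ ^ (N + 2) - 2 * δ * ρ ^ N) * ω) ^ 2 ≤
        4 * (N / (N + 2) * (ρ ^ (N + 2) * ω)) := by
    intro δ hδ hpos
    set w : 𝔼 → ℝ := fun x => smoothPosPart δ (ρ ^ 2 - ‖x‖ ^ 2) with hw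
    have hwc : ContDiff ℝ (⊤ : ℕ∞) w :=
      (contDiff_smoothPosPart δ).comp (contDiff_const.sub (contDiff_norm_sq ℝ))
    have hsupp : tsupport w ⊆ ball 0 ρ := by
      have hcl : IsClosed {x : 𝔼 | ‖x‖ ^ 2 ≤ ρ ^ 2 - δ} :=
        isClosed_le (by fun_prop) continuous_const
      refine (closure_minimal (fun x hx => ?_) hcl).trans fun x hx => ?_
      · by_contra hx'
        simp only [mem_ofPred_eq, not_le] at hx'
        exact hx (smoothPosPart_eq_zero hδ (by linarith))
      · simp only [mem_ofPred_eq] at hx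
        rw [mem_ball_zero_iff]
        exact lt_of_pow_lt_pow_left₀ 2 hρ.le (by linarith)
    have hcs : HasCompactSupport w :=
      (isCompact_closedBall (0 : 𝔼) ρ).of_isClosed_subset (isClosed_tsupport w)
        (hsupp.trans ball_subset_closedBall)
    have hwint : Integrable w := hwc.continuous.integrable_of_hasCompactSupport hcs
    have hI : (2 / (N + 2) * ρ ^ (N + 2) - 2 * δ * ρ ^ N) * ω ≤ ∫ x, w x := by
      rw [hω, ← setIntegral_ball_sub_norm_sq hN hρ,
        ← setIntegral_eq_integral_of_forall_compl_eq_zero (s := ball (0 : 𝔼) ρ) (f := w)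
          fun x hx => image_eq_zero_of_notMem_tsupport fun h => hx (hsupp h)]
      have hcont : Continuous fun x : 𝔼 => ρ ^ 2 - ‖x‖ ^ 2 - 2 * δ := by fun_prop
      refine setIntegral_mono ((hcont.continuousOn.integrableOn_compact
        (isCompact_closedBall 0 ρ)).mono_set ball_subset_closedBall) hwint.integrableOn fun x => ?_
      exact sub_le_smoothPosPart hδ _
    have hD : ∫ x, ‖fderiv ℝ w x‖ ^ 2 ≤ 4 * (N / (N + 2) * (ρ ^ (N + 2) * ω)) := by
      rw [hω, ← setIntegral_ball_norm_sq hN hρ, ← integral_const_mul,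
        ← setIntegral_eq_integral_of_forall_compl_eq_zero (s := ball (0 : 𝔼) ρ)
          (f := fun x => ‖fderiv ℝ w x‖ ^ 2) fun x hx => by
            rw [image_eq_zero_of_notMem_tsupport (f := fderiv ℝ w)
              fun h => hx (hsupp (tsupport_fderiv_subset ℝ h))]
            simp]
      have hcont : Continuous fun x : 𝔼 => 4 * ‖x‖ ^ 2 := by fun_prop
      have hcont' : Continuous fun x : 𝔼 => ‖fderiv ℝ w x‖ ^ 2 :=
        (hwc.continuous_fderiv (by simp)).norm.pow 2
      refine setIntegral_mono ((hcont'.continuousOn.integrableOn_compact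
        (isCompact_closedBall 0 ρ)).mono_set ball_subset_closedBall)
        ((hcont.continuousOn.integrableOn_compact
        (isCompact_closedBall 0 ρ)).mono_set ball_subset_closedBall) fun x => ?_
      have hder : HasFDerivAt w (Real.smoothTransition ((ρ ^ 2 - ‖x‖ ^ 2) / δ - 1) •
          -((2 : ℝ) • innerSL ℝ x)) x := by
        refine (hasDerivAt_smoothPosPart δ _).comp_hasFDerivAt x ?_
        have h := (hasStrictFDerivAt_norm_sq x).hasFDerivAt.const_sub (ρ ^ 2)
        rw [← Nat.cast_smul_eq_nsmul ℝ] at h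
        exact_mod_cast h
      have hnorm : ‖fderiv ℝ w x‖ ≤ 2 * ‖x‖ := by
        rw [hder.fderiv, norm_smul, norm_neg, norm_smul, innerSL_apply_norm, Real.norm_of_nonneg
          (Real.smoothTransition.nonneg _), Real.norm_of_nonneg zero_le_two]
        exact mul_le_of_le_one_left (by positivity) (Real.smoothTransition.le_one _)
      calc ‖fderiv ℝ w x‖ ^ 2 ≤ (2 * ‖x‖) ^ 2 := by gcongr
        _ = 4 * ‖x‖ ^ 2 := by ring
    refine le_trans ?_ ((torsionEnergy_mul_sq_le hwc hcs hsupp (hpos.trans_le hI)).trans hD)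
    gcongr
  have hc : Continuous fun δ : ℝ => (2 / (N + 2) * ρ ^ (N + 2) - 2 * δ * ρ ^ N) * ω := by fun_prop
  have ht : Tendsto (fun δ : ℝ => (2 / (N + 2) * ρ ^ (N + 2) - 2 * δ * ρ ^ N) * ω) (𝓝[>] 0)
      (𝓝 (2 / (N + 2) * ρ ^ (N + 2) * ω)) := by
    simpa using (hc.tendsto 0).mono_left nhdsWithin_le_nhds
  have hpos : ∀ᶠ δ in 𝓝[>] (0 : ℝ), 0 < (2 / (N + 2) * ρ ^ (N + 2) - 2 * δ * ρ ^ N) * ω :=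
    ht.eventually_const_lt (by positivity)
  have hlim := le_of_tendsto ((ht.pow 2).const_mul J) (by
    filter_upwards [hpos, self_mem_nhdsWithin] with δ h1 h2 using key δ h2 h1)
  rw [le_div_iff₀ (by positivity)]
  have h2 : (0 : ℝ) < N + 2 := by positivity
  set q := ρ ^ (N + 2) * ω with hq
  have hq0 : 0 < q := by positivity
  have h3 : J * (2 / (N + 2) * ρ ^ (N + 2) * ω) ^ 2 = (4 * q / (N + 2) ^ 2) * (J * q) := by
    rw [hq]; field_simp; ring
  have h4 : 4 * (N / (N + 2) * q) = (4 * q / (N + 2) ^ 2) * (N * (N + 2)) := by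
    field_simp
  rw [h3, h4] at hlim
  exact le_of_mul_le_mul_left hlim (by positivity)

/-- **Saint-Venant inequality**. -/
theorem le_torsionEnergy (hN : 1 ≤ N) {Ω : Set 𝔼} (hΩ : IsOpen Ω) {ρ : ℝ} (hρ : 0 < ρ)
    (hv : volume Ω = volume (ball (0 : 𝔼) ρ)) :
    N * (N + 2) / (ρ ^ (N + 2) * volume.real (ball (0 : 𝔼) 1)) ≤ torsionEnergy Ω := by
  refine le_csInf ?_ ?_
  · have hne : Ω.Nonempty := by
      refine nonempty_of_measure_ne_zero (μ := volume) ?_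
      rw [hv]
      exact (measure_ball_pos _ _ hρ).ne'
    obtain ⟨c, hc⟩ := hne
    obtain ⟨r, hr, hrΩ⟩ := nhds_basis_closedBall.mem_iff.1 (hΩ.mem_nhds hc)
    let f : ContDiffBump c := ⟨r / 2, r, half_pos hr, half_lt_self hr⟩
    exact ⟨_, f.normed volume, f.contDiff_normed, f.hasCompactSupport_normed,
      by rw [f.tsupport_normed_eq]; exact hrΩ, f.integral_normed, rfl⟩
  · rintro e ⟨u, hu, hc, huΩ, h1, rfl⟩
    simp_rw [norm_gradient]
    refine le_integral_norm_fderiv_sq hN hu hc h1 hρ ?_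
    rw [measureReal_def, measureReal_def, ← hv]
    refine ENNReal.toReal_mono ?_ (measure_mono huΩ)
    rw [hv]
    exact measure_ball_lt_top.ne

theorem torsionEnergy_ball (hN : 1 ≤ N) {ρ : ℝ} (hρ : 0 < ρ) :
    torsionEnergy (ball (0 : 𝔼) ρ) =
      N * (N + 2) / (ρ ^ (N + 2) * volume.real (ball (0 : 𝔼) 1)) :=
  le_antisymm (torsionEnergy_ball_le hN hρ) (le_torsionEnergy hN isOpen_ball hρ rfl)

lemma torsionProfile_volume_ball (hN : 1 ≤ N) {ρ : ℝ} (hρ : 0 < ρ) :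
    torsionProfile N (volume.real (ball (0 : 𝔼) ρ)) = torsionEnergy (ball (0 : 𝔼) ρ) := by
  refine IsLeast.csInf_eq ⟨⟨ball 0 ρ, isOpen_ball, isBounded_ball,
    (ENNReal.ofReal_toReal measure_ball_lt_top.ne).symm, rfl⟩, ?_⟩
  rintro e ⟨Ω, hΩ, -, hv, rfl⟩
  rw [measureReal_def, ENNReal.ofReal_toReal measure_ball_lt_top.ne] at hv
  rw [torsionEnergy_ball hN hρ]
  exact le_torsionEnergy hN hΩ hρ hv

end Dirichlet

/-- Saint-Venant / Faber–Krahn for the torsion problem in `ℝ^N`: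
`𝒯_{ℝ^N}(v) = (|B₁|/v)^{(N+2)/N} · J(B₁)`. -/
theorem torsionProfile_eq (N : ℕ) (hN : 1 ≤ N) (v : ℝ) (hv : 0 < v) :
    torsionProfile N v =
      ((volume (Metric.ball (0 : EuclideanSpace ℝ (Fin N)) 1)).toReal / v) ^
          (((N : ℝ) + 2) / N) *
        torsionEnergy (Metric.ball (0 : EuclideanSpace ℝ (Fin N)) 1) := by
  rw [← measureReal_def]
  set ω := volume.real (ball (0 : EuclideanSpace ℝ (Fin N)) 1) with hω
  have hω0 : 0 < ω := volume_real_ball_pos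
  have hN0 : (N : ℝ) ≠ 0 := by positivity
  set ρ := (v / ω) ^ (1 / (N : ℝ)) with hρ
  have hρ0 : 0 < ρ := by positivity
  have hρN : ρ ^ N = v / ω := by
    rw [hρ, ← Real.rpow_natCast, ← Real.rpow_mul (by positivity), one_div_mul_cancel hN0,
      Real.rpow_one]
  have hρv : v = volume.real (ball (0 : EuclideanSpace ℝ (Fin N)) ρ) := by
    rw [volume_real_ball hρ0, hρN, ← hω, div_mul_cancel₀ _ hω0.ne']
  have hpow : (ω / v) ^ (((N : ℝ) + 2) / N) = (ρ ^ (N + 2))⁻¹ := by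
    rw [← inv_div v ω, Real.inv_rpow (by positivity), hρ, ← Real.rpow_natCast,
      ← Real.rpow_mul (by positivity)]
    congr 2
    push_cast
    ring
  rw [hpow, hρv, torsionProfile_volume_ball hN hρ0, torsionEnergy_ball hN hρ0,
    torsionEnergy_ball hN one_pos, ← hω]
  simp only [one_pow, one_mul]
  field_simp
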